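/- Let n ≥ 3, let S = {0} × S^{n−2} ⊂ ℝ × ℝ^{n−1} = ℝⁿ, and let C(n) = 𝓗^{n−2}(S^{n−2}). Define e : ℝⁿ \ S → ℝ by e(p) = C(n)^{−1} ∫_{S} |p − y|^{2−n} d𝓗^{n−2}(y). Then e is differentiable on ℝⁿ \ S and there is a constant C > 0 depending only on n such that |∇e(p)| ≤ C / dist(p, S) for every p ∈ ℝⁿ \ S. In particular, writing p = (t, x′) with |x′| = R, one has |∇e(p)| ≤ C (t² + (R−1)²)^{−1/2}. -/

import Mathlib

open MeasureTheory

noncomputable section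

/-- `ℝⁿ`, presented as the Euclidean (`L²`) product `ℝ × ℝ^{n−1}` so that the first coordinate
`t` and the orthogonal part `x′` can be singled out. -/
abbrev EucProd (n : ℕ) := WithLp 2 (ℝ × EuclideanSpace ℝ (Fin (n - 1)))

/-- The first coordinate `t` of `p = (t, x′) ∈ ℝ × ℝ^{n−1}`. -/
def fst' (n : ℕ) (p : EucProd n) : ℝ :=
  (WithLp.equiv 2 (ℝ × EuclideanSpace ℝ (Fin (n - 1))) p).1

/-- The orthogonal part `x′` of `p = (t, x′) ∈ ℝ × ℝ^{n−1}`. -/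
def snd' (n : ℕ) (p : EucProd n) : EuclideanSpace ℝ (Fin (n - 1)) :=
  (WithLp.equiv 2 (ℝ × EuclideanSpace ℝ (Fin (n - 1))) p).2

/-- The isometric embedding `y ↦ (0, y)` of `ℝ^{n−1}` into `ℝⁿ = ℝ × ℝ^{n−1}`. -/
def emb (n : ℕ) (y : EuclideanSpace ℝ (Fin (n - 1))) : EucProd n :=
  (WithLp.equiv 2 (ℝ × EuclideanSpace ℝ (Fin (n - 1)))).symm (0, y)

/-- The sphere `S = {0} × S^{n−2} ⊂ ℝ × ℝ^{n−1} = ℝⁿ`. -/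
def sphS (n : ℕ) : Set (EucProd n) :=
  emb n '' Metric.sphere (0 : EuclideanSpace ℝ (Fin (n - 1))) 1

/-- `C(n) = 𝓗^{n−2}(S^{n−2})`. -/
def sphC (n : ℕ) : ℝ :=
  (μH[(n : ℝ) - 2] (Metric.sphere (0 : EuclideanSpace ℝ (Fin (n - 1))) 1)).toReal

/-- `e(p) = C(n)⁻¹ ∫_S |p − y|^{2−n} d𝓗^{n−2}(y)`, the Newtonian potential of the normalized
Hausdorff measure on `S = {0} × S^{n−2}`. -/
def ePot (n : ℕ) (p : EucProd n) : ℝ :=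
  (sphC n)⁻¹ *
    ∫ y in Metric.sphere (0 : EuclideanSpace ℝ (Fin (n - 1))) 1,
      ‖p - emb n y‖ ^ ((2 : ℝ) - n) ∂(μH[(n : ℝ) - 2])

lemma fst_snd_norm (n : ℕ) (p : EucProd n) (y : EuclideanSpace ℝ (Fin (n - 1))) :
    ‖p - emb n y‖ ^ 2 = fst' n p ^ 2 + ‖snd' n p - y‖ ^ 2 := by
  rw [WithLp.prod_norm_sq_eq_of_L2]
  simp [fst', snd', emb]

lemma emb_cont (n : ℕ) : Continuous (emb n) := by
  have : emb n = fun y => WithLp.toLp 2 (0, y) := rfl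
  rw [this]
  fun_prop

lemma norm_rpow_hasFDerivAt {E : Type*} [NormedAddCommGroup E] [InnerProductSpace ℝ E]
    (a : ℝ) (q p : E) (h : p - q ≠ 0) :
    HasFDerivAt (fun x => ‖x - q‖ ^ a) ((a * ‖p - q‖ ^ (a - 2)) • innerSL ℝ (p - q)) p := by
  have h1 : HasFDerivAt (fun x : E => ‖x - q‖ ^ 2) ((2:ℝ) • innerSL ℝ (p - q)) p := by
    have := ((hasFDerivAt_id p).sub_const q).norm_sq
    refine HasFDerivAt.congr_fderiv this ?_
    ext v
    simp
  have hpos : 0 < ‖p - q‖ := norm_pos_iff.2 h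
  have h2 := h1.rpow_const (p := a / 2) (Or.inl (by positivity))
  have e : ∀ x b : ℝ, 0 ≤ x → (x ^ 2) ^ (b / 2) = x ^ b := by
    intro x b hx
    rw [← Real.rpow_natCast, ← Real.rpow_mul hx]
    congr 1; push_cast; ring
  have h3 : (fun x => ‖x - q‖ ^ a) = fun x => (‖x - q‖ ^ 2) ^ (a / 2) := by
    ext x; rw [e _ _ (norm_nonneg _)]
  rw [h3]
  convert h2 using 1
  rw [show a / 2 - 1 = (a - 2) / 2 by ring, e _ _ (norm_nonneg _), smul_smul]
  congr 1; ring

/-- One coordinate patch. -/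
lemma patch_bound (m : ℕ) (i : Fin m) (d : ℝ) (hd : d = ((m - 1 : ℕ) : ℝ)) (c : ℝ) (hc : 0 < c) (s : Set (EuclideanSpace ℝ (Fin m)))
    (hs : ∀ y ∈ s, ‖y‖ = 1) (hs2 : ∀ y ∈ s, ∀ z ∈ s, 2 * c * |y i - z i| ≤ |y i ^ 2 - z i ^ 2|) :
    ∃ A : ℝ, 0 ≤ A ∧ ∀ (x : EuclideanSpace ℝ (Fin m)) (r : ℝ), 0 < r →
      μH[d] (s ∩ Metric.closedBall x r) ≤ ENNReal.ofReal (A * r ^ (m - 1)) := by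
  classical
  let f : s → ({j : Fin m // j ≠ i} → ℝ) := fun y j => (y : EuclideanSpace ℝ (Fin m)) j
  have hnorm : ∀ y : EuclideanSpace ℝ (Fin m), ‖y‖ ^ 2 = y i ^ 2 + ∑ j : {j : Fin m // j ≠ i}, y j ^ 2 := by
    intro y
    rw [EuclideanSpace.norm_sq_eq, Fintype.sum_eq_add_sum_subtype_ne _ i]
    simp
  have hcoord : ∀ (y : EuclideanSpace ℝ (Fin m)) j, |y j| ≤ ‖y‖ := fun y j => by
    simpa using PiLp.norm_apply_le y j
  set K : ℝ := m * (1 / c + 1) with hK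
  have hK0 : 0 ≤ K := by positivity
  have hf : AntilipschitzWith (Real.toNNReal K) f := by
    refine AntilipschitzWith.of_le_mul_dist fun y z => ?_
    rw [Real.coe_toNNReal _ hK0]
    obtain ⟨y, hy⟩ := y
    obtain ⟨z, hz⟩ := z
    set D := dist (f ⟨y, hy⟩) (f ⟨z, hz⟩) with hD
    have hD0 : 0 ≤ D := dist_nonneg
    have hj : ∀ j, j ≠ i → |y j - z j| ≤ D := by
      intro j hj
      have := dist_le_pi_dist (f ⟨y, hy⟩) (f ⟨z, hz⟩) ⟨j, hj⟩
      simpa [f, Real.dist_eq] using this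
    have hm1 : (1:ℝ) ≤ m := by exact_mod_cast (Nat.one_le_iff_ne_zero.2 (by rintro rfl; exact i.elim0))
    have hi : |y i - z i| ≤ m * (1 / c) * D := by
      have h1 := hnorm y
      have h2 := hnorm z
      rw [hs y hy] at h1
      rw [hs z hz] at h2
      have h3 : y i ^ 2 - z i ^ 2 = ∑ j : {j : Fin m // j ≠ i}, (z j ^ 2 - y j ^ 2) := by
        rw [Finset.sum_sub_distrib]; linarith
      have h4 : |y i ^ 2 - z i ^ 2| ≤ ∑ j : {j : Fin m // j ≠ i}, (2 * D) := by
        rw [h3]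
        refine (Finset.abs_sum_le_sum_abs _ _).trans (Finset.sum_le_sum fun j _ => ?_)
        have ha := hcoord y j
        have hb := hcoord z j
        rw [hs y hy] at ha
        rw [hs z hz] at hb
        have hab : |z j + y j| ≤ 2 := (abs_add_le _ _).trans (by linarith)
        have : z j ^ 2 - y j ^ 2 = (z j + y j) * (z j - y j) := by ring
        rw [this, abs_mul, abs_sub_comm]
        exact mul_le_mul hab (hj j j.2) (abs_nonneg _) (by norm_num)
      have h5 : ∑ j : {j : Fin m // j ≠ i}, (2 * D) ≤ m * (2 * D) := by
        rw [Finset.sum_const, nsmul_eq_mul]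
        refine mul_le_mul_of_nonneg_right ?_ (by positivity)
        have := Fintype.card_subtype_le (fun j : Fin m => j ≠ i)
        rw [Fintype.card_fin] at this
        exact_mod_cast this
      have h6 := hs2 y hy z hz
      have h7 : |y i - z i| * c ≤ m * D := by nlinarith
      rw [show m * (1 / c) * D = (m * D) / c by ring, le_div_iff₀ hc]
      exact h7
    rw [Subtype.dist_eq, dist_eq_norm]
    have h8 : ‖y - z‖ ≤ ∑ j, |y j - z j| := by
      have h9 : ‖y - z‖ ^ 2 ≤ (∑ j, |y j - z j|) ^ 2 := by
        rw [EuclideanSpace.norm_sq_eq]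
        simpa using Finset.sum_sq_le_sq_sum_of_nonneg (s := Finset.univ) (f := fun j => |y j - z j|) (fun j _ => abs_nonneg _)
      exact le_of_sq_le_sq h9 (Finset.sum_nonneg fun j _ => abs_nonneg _)
    rw [Fintype.sum_eq_add_sum_subtype_ne (fun j => |y j - z j|) i] at h8
    have h10 : ∑ j : {j : Fin m // j ≠ i}, |y j - z j| ≤ m * D := by
      have hle : ∀ j ∈ (Finset.univ : Finset {j : Fin m // j ≠ i}), |y j - z j| ≤ D :=
        fun j _ => hj j j.2
      refine (Finset.sum_le_sum hle).trans ?_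
      rw [Finset.sum_const, nsmul_eq_mul]
      refine mul_le_mul_of_nonneg_right ?_ (by positivity)
      have := Fintype.card_subtype_le (fun j : Fin m => j ≠ i)
      rw [Fintype.card_fin] at this
      exact_mod_cast this
    rw [hK]; nlinarith
  have hcard : Fintype.card {j : Fin m // j ≠ i} = m - 1 := by simp
  refine ⟨K ^ (m - 1) * 2 ^ (m - 1), by positivity, fun x r hr => ?_⟩
  have h1 : s ∩ Metric.closedBall x r = (Subtype.val : s → _) '' (Subtype.val ⁻¹' Metric.closedBall x r) := by
    rw [Subtype.image_preimage_coe]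
  have hd0 : 0 ≤ d := by rw [hd]; positivity
  rw [h1, isometry_subtype_coe.hausdorffMeasure_image (Or.inl hd0)]
  refine (hf.le_hausdorffMeasure_image hd0 _).trans ?_
  have h2 : f '' (Subtype.val ⁻¹' Metric.closedBall x r) ⊆ Metric.closedBall (fun j : {j : Fin m // j ≠ i} => x j) r := by
    rintro _ ⟨⟨y, hy⟩, hyr, rfl⟩
    rw [Metric.mem_closedBall, dist_pi_le_iff hr.le]
    intro j
    simp only [Set.mem_preimage, Metric.mem_closedBall, dist_eq_norm] at hyr
    have := hcoord (y - x) j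
    simp only [PiLp.sub_apply] at this
    rw [Real.dist_eq]
    exact this.trans hyr
  have h3 := measure_mono (μ := μH[d]) h2
  have h4 : (μH[d] : Measure ({j : Fin m // j ≠ i} → ℝ)) = volume := by
    rw [hd, ← hcard]; exact hausdorffMeasure_pi_real
  rw [h4, Real.volume_pi_closedBall _ hr.le, hcard] at h3
  rw [h4]
  refine (mul_le_mul_right h3 _).trans ?_
  rw [hd, ENNReal.rpow_natCast, show ((Real.toNNReal K : NNReal) : ENNReal) = ENNReal.ofReal K from rfl,
    ← ENNReal.ofReal_pow hK0, ← ENNReal.ofReal_mul (by positivity)]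
  apply le_of_eq
  congr 1
  rw [mul_pow]; ring

lemma sphere_bound (m : ℕ) (hm : 1 ≤ m) (d : ℝ) (hd : d = ((m - 1 : ℕ) : ℝ)) :
    ∃ A : ℝ, 0 ≤ A ∧ ∀ (x : EuclideanSpace ℝ (Fin m)) (r : ℝ), 0 < r →
      μH[d] (Metric.sphere 0 1 ∩ Metric.closedBall x r) ≤ ENNReal.ofReal (A * r ^ (m - 1)) := by
  have hm0 : (0:ℝ) < m := by exact_mod_cast hm
  set c : ℝ := 1 / m with hcdef
  have hc : 0 < c := by positivity
  let s : Fin m × Bool → Set (EuclideanSpace ℝ (Fin m)) := fun k =>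
    {y | ‖y‖ = 1 ∧ c ≤ (if k.2 then (1:ℝ) else -1) * y k.1}
  have key : ∀ k, ∃ A : ℝ, 0 ≤ A ∧ ∀ (x : EuclideanSpace ℝ (Fin m)) (r : ℝ), 0 < r →
      μH[d] (s k ∩ Metric.closedBall x r) ≤ ENNReal.ofReal (A * r ^ (m - 1)) := by
    rintro ⟨i, b⟩
    refine patch_bound m i d hd c hc (s (i, b)) (fun y hy => hy.1) ?_
    rintro y ⟨-, hy⟩ z ⟨-, hz⟩
    have : y i ^ 2 - z i ^ 2 = (y i + z i) * (y i - z i) := by ring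
    rw [this, abs_mul]
    refine mul_le_mul_of_nonneg_right ?_ (abs_nonneg _)
    cases b
    · simp only [Bool.false_eq_true, if_false] at hy hz
      have := neg_abs_le (y i + z i)
      linarith
    · simp only [if_true] at hy hz
      have := le_abs_self (y i + z i)
      linarith
  choose A hA0 hA using key
  refine ⟨∑ k, A k, Finset.sum_nonneg fun k _ => hA0 k, fun x r hr => ?_⟩
  have hsub : Metric.sphere (0 : EuclideanSpace ℝ (Fin m)) 1 ∩ Metric.closedBall x r ⊆
      ⋃ k, (s k ∩ Metric.closedBall x r) := by
    rintro y ⟨hy, hyr⟩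
    have hy1 : ‖y‖ = 1 := by simpa using hy
    have : ∃ i, c ≤ |y i| := by
      by_contra! hcon
      have h1 : ∑ i, y i ^ 2 = 1 := by
        have := EuclideanSpace.norm_sq_eq y
        rw [hy1] at this
        simpa using this.symm
      have hne : (Finset.univ : Finset (Fin m)).Nonempty := ⟨⟨0, hm⟩, Finset.mem_univ _⟩
      have h2 : ∑ i, y i ^ 2 < ∑ i : Fin m, c := by
        refine Finset.sum_lt_sum_of_nonempty hne fun i _ => ?_
        have hc1 : c ≤ 1 := by
          rw [hcdef, div_le_one hm0]; exact_mod_cast hm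
        rw [← sq_abs]
        have := hcon i
        nlinarith [abs_nonneg (y i)]
      rw [h1] at h2
      simp [hcdef] at h2
      rw [mul_inv_cancel₀ hm0.ne'] at h2
      exact lt_irrefl _ h2
    obtain ⟨i, hi⟩ := this
    rcases le_abs.1 hi with h | h
    · exact Set.mem_iUnion.2 ⟨(i, true), ⟨hy1, by simpa using h⟩, hyr⟩
    · exact Set.mem_iUnion.2 ⟨(i, false), ⟨hy1, by simpa using h⟩, hyr⟩
  refine (measure_mono hsub).trans ((measure_iUnion_fintype_le _ _).trans ?_)
  rw [Finset.sum_mul, ENNReal.ofReal_sum_of_nonneg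
    (fun k _ => mul_nonneg (hA0 k) (by positivity))]
  exact Finset.sum_le_sum fun k _ => hA k x r hr

lemma lint_bound {X : Type*} [MeasurableSpace X] (μ : Measure X) (d : ℕ) (A : ℝ) (hA : 0 ≤ A)
    (g : X → ℝ) (hg : Measurable g) (δ : ℝ) (hδ : 0 < δ) (hgd : ∀ᵐ y ∂μ, δ ≤ g y)
    (hμ : ∀ r, 0 < r → μ {y | g y ≤ r} ≤ ENNReal.ofReal (A * r ^ d)) :
    ∫⁻ y, ENNReal.ofReal ((g y ^ (d + 1))⁻¹) ∂μ ≤ ENNReal.ofReal (A * 2 ^ (d + 1) / δ) := by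
  let T : ℕ → Set X := fun k => {y | g y ≤ 2 ^ (k + 1) * δ}
  have hT : ∀ k, MeasurableSet (T k) := fun k => measurableSet_le hg measurable_const
  let w : ℕ → ENNReal := fun k => ENNReal.ofReal (((2 ^ k * δ) ^ (d + 1))⁻¹)
  have h1 : ∫⁻ y, ENNReal.ofReal ((g y ^ (d + 1))⁻¹) ∂μ ≤
      ∫⁻ y, ∑' k, (T k).indicator (fun _ => w k) y ∂μ := by
    refine lintegral_mono_ae ?_
    filter_upwards [hgd] with y hy
    obtain ⟨k, hk1, hk2⟩ := exists_nat_pow_near (x := g y / δ) (y := (2:ℝ))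
      ((one_le_div hδ).2 hy) (by norm_num)
    rw [le_div_iff₀ hδ] at hk1
    rw [div_lt_iff₀ hδ] at hk2
    refine le_trans ?_ (ENNReal.le_tsum k)
    rw [Set.indicator_of_mem (show y ∈ T k from hk2.le)]
    refine ENNReal.ofReal_le_ofReal ?_
    gcongr
  refine h1.trans ?_
  rw [lintegral_tsum fun k => (measurable_const.indicator (hT k)).aemeasurable]
  have h2 : ∀ k, ∫⁻ y, (T k).indicator (fun _ => w k) y ∂μ ≤
      ENNReal.ofReal (A * 2 ^ d / δ * (1 / 2) ^ k) := by
    intro k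
    rw [lintegral_indicator_const (hT k)]
    refine (mul_le_mul_right (hμ _ (by positivity)) _).trans ?_
    rw [← ENNReal.ofReal_mul (by positivity)]
    apply le_of_eq
    congr 1
    rw [mul_pow, mul_pow, one_div, inv_pow, pow_succ (2:ℝ) k, mul_pow, pow_succ ((2:ℝ)^k) d, pow_succ δ]
    field_simp
  refine (ENNReal.tsum_le_tsum h2).trans ?_
  rw [← ENNReal.ofReal_tsum_of_nonneg (fun k => by positivity)
    (summable_geometric_two.mul_left _), tsum_mul_left, tsum_geometric_two]
  apply le_of_eq
  congr 1
  ring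

lemma main_aux (n : ℕ) (hn : 3 ≤ n) : ∃ C : ℝ, 0 < C ∧ ∀ (p : EucProd n) (δ : ℝ), 0 < δ →
    (∀ y ∈ Metric.sphere (0 : EuclideanSpace ℝ (Fin (n - 1))) 1, δ ≤ ‖p - emb n y‖) →
    DifferentiableAt ℝ (ePot n) p ∧ ‖fderiv ℝ (ePot n) p‖ ≤ C / δ := by
  have hd : (n : ℝ) - 2 = ((n - 1 - 1 : ℕ) : ℝ) := by
    rw [Nat.sub_sub, Nat.cast_sub (by omega)]; norm_num
  obtain ⟨A, hA0, hA⟩ := sphere_bound (n - 1) (by omega) _ hd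
  set S := Metric.sphere (0 : EuclideanSpace ℝ (Fin (n - 1))) 1 with hS
  have hSm : MeasurableSet S := Metric.isClosed_sphere.measurableSet
  have hn3 : (3:ℝ) ≤ n := by exact_mod_cast hn
  have hC0 : 0 ≤ sphC n := ENNReal.toReal_nonneg
  set d := n - 1 - 1 with hddef
  have hnd : (n : ℝ) = d + 2 := by linarith
  refine ⟨(sphC n)⁻¹ * (d * (A * 2 ^ (d + 1))) + 1, by positivity, fun p δ hδ hp => ?_⟩
  set μ := (μH[(n : ℝ) - 2]).restrict S with hμ
  have hfin : IsFiniteMeasure μ := by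
    refine ⟨?_⟩
    rw [hμ, Measure.restrict_apply_univ]
    have : S ⊆ S ∩ Metric.closedBall 0 1 := fun y hy =>
      ⟨hy, Metric.sphere_subset_closedBall hy⟩
    exact ((measure_mono this).trans (hA 0 1 one_pos)).trans_lt ENNReal.ofReal_lt_top
  have haeS : ∀ᵐ y ∂μ, y ∈ S := ae_restrict_mem hSm
  let F : EucProd n → EuclideanSpace ℝ (Fin (n - 1)) → ℝ := fun x y =>
    ‖x - emb n y‖ ^ ((2 : ℝ) - n)
  let F' : EucProd n → EuclideanSpace ℝ (Fin (n - 1)) → (EucProd n →L[ℝ] ℝ) := fun x y =>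
    (((2 : ℝ) - n) * ‖x - emb n y‖ ^ ((2 : ℝ) - n - 2)) • innerSL ℝ (x - emb n y)
  have hemb := emb_cont n
  have hball : ∀ x ∈ Metric.ball p (δ / 2), ∀ y ∈ S, δ / 2 ≤ ‖x - emb n y‖ := by
    intro x hx y hy
    have h1 := hp y hy
    have h2 : ‖p - emb n y‖ ≤ ‖p - x‖ + ‖x - emb n y‖ := norm_sub_le_norm_sub_add_norm_sub _ _ _
    rw [Metric.mem_ball', dist_eq_norm] at hx
    linarith
  have hF'norm : ∀ x y, 0 < ‖x - emb n y‖ → ‖F' x y‖ = d * (‖x - emb n y‖ ^ (d + 1))⁻¹ := by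
    intro x y h
    simp only [F', norm_smul, innerSL_apply_norm, norm_mul, Real.norm_eq_abs]
    rw [abs_of_nonneg (Real.rpow_nonneg h.le _), hnd, show (2:ℝ) - (d + 2) = -d by ring, abs_neg,
      Nat.abs_cast, mul_assoc]
    congr 1
    rw [← Real.rpow_add_one h.ne', ← Real.rpow_natCast, ← Real.rpow_neg h.le]
    congr 1
    push_cast; ring
  have hmeasF : ∀ x, AEStronglyMeasurable (F x) μ := by
    intro x
    have : Measurable (F x) := by
      have h1 : Measurable fun y => ‖x - emb n y‖ := (by fun_prop : Continuous _).measurable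
      exact h1.pow_const _
    exact this.aestronglyMeasurable
  have hball0 : ∀ y ∈ S, 0 < ‖p - emb n y‖ := fun y hy => hδ.trans_le (hp y hy)
  have hderiv : HasFDerivAt (fun x => ∫ y, F x y ∂μ) (∫ y, F' p y ∂μ) p := by
    refine hasFDerivAt_integral_of_dominated_of_fderiv_le (F := F) (F' := F')
      (bound := fun _ => d * ((δ / 2) ^ (d + 1))⁻¹)
      (Metric.ball_mem_nhds p (half_pos hδ)) (Filter.Eventually.of_forall hmeasF) ?_ ?_ ?_
      (integrable_const _) ?_
    · refine Integrable.of_bound (hmeasF p) (δ ^ ((2:ℝ) - n)) ?_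
      filter_upwards [haeS] with y hy
      rw [Real.norm_eq_abs, abs_of_nonneg (Real.rpow_nonneg (norm_nonneg _) _)]
      exact Real.rpow_le_rpow_of_nonpos hδ (hp y hy) (by linarith)
    · refine ContinuousOn.aestronglyMeasurable ?_ hSm
      have hc1 : Continuous fun y => p - emb n y := by fun_prop
      have hc2 : ContinuousOn (fun y => innerSL ℝ (p - emb n y)) S :=
        ((innerSL ℝ).continuous.comp hc1).continuousOn
      have hc3 : ContinuousOn
          (fun y => ((2 : ℝ) - n) * ‖p - emb n y‖ ^ ((2 : ℝ) - n - 2)) S :=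
        continuousOn_const.mul
          (ContinuousOn.rpow_const hc1.norm.continuousOn fun y hy => Or.inl (hball0 y hy).ne')
      exact hc3.smul hc2
    · filter_upwards [haeS] with y hy x hx
      have := hball x hx y hy
      rw [hF'norm x y (by linarith)]
      gcongr
    · filter_upwards [haeS] with y hy x hx
      have := hball x hx y hy
      exact norm_rpow_hasFDerivAt _ _ _ (norm_pos_iff.1 (by linarith))
  have hderiv2 : HasFDerivAt (ePot n) ((sphC n)⁻¹ • ∫ y, F' p y ∂μ) p := hderiv.const_mul _
  refine ⟨hderiv2.differentiableAt, ?_⟩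
  rw [hderiv2.fderiv, norm_smul, Real.norm_eq_abs, abs_of_nonneg (inv_nonneg.2 hC0)]
  have hint : ‖∫ y, F' p y ∂μ‖ ≤ d * (A * 2 ^ (d + 1) / δ) := by
    refine (norm_integral_le_lintegral_norm _).trans ?_
    refine ENNReal.toReal_le_of_le_ofReal (by positivity) ?_
    have e : ∫⁻ y, ENNReal.ofReal ‖F' p y‖ ∂μ =
        ENNReal.ofReal d * ∫⁻ y, ENNReal.ofReal ((‖p - emb n y‖ ^ (d + 1))⁻¹) ∂μ := by
      rw [← lintegral_const_mul' _ _ ENNReal.ofReal_ne_top]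
      refine lintegral_congr_ae ?_
      filter_upwards [haeS] with y hy
      rw [hF'norm p y (hball0 y hy), ENNReal.ofReal_mul (by positivity)]
    rw [e, ENNReal.ofReal_mul (by positivity)]
    refine mul_le_mul_right ?_ _
    refine lint_bound μ d A hA0 _ (by fun_prop : Continuous fun y => ‖p - emb n y‖).measurable δ hδ
      (haeS.mono fun y hy => hp y hy) ?_
    intro r hr
    rw [hμ, Measure.restrict_apply' hSm]
    refine (measure_mono ?_).trans (hA (snd' n p) r hr)
    rintro y ⟨hy, hyS⟩
    refine ⟨hyS, ?_⟩
    rw [Metric.mem_closedBall', dist_eq_norm]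
    refine le_trans ?_ (show ‖p - emb n y‖ ≤ r from hy)
    refine le_of_sq_le_sq ?_ (norm_nonneg _)
    rw [fst_snd_norm]
    nlinarith [sq_nonneg (fst' n p)]
  calc (sphC n)⁻¹ * ‖∫ y, F' p y ∂μ‖ ≤ (sphC n)⁻¹ * (d * (A * 2 ^ (d + 1) / δ)) := by gcongr
    _ = ((sphC n)⁻¹ * (d * (A * 2 ^ (d + 1)))) / δ := by ring
    _ ≤ _ := by gcongr; linarith

/-- For `n ≥ 3`, the potential `e` is differentiable on `ℝⁿ \ S` and there is
`C > 0` (depending only on `n`) with `|∇e(p)| ≤ C / dist(p,S)` for all `p ∉ S`; in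
particular, writing `p = (t,x′)` with `R = |x′|`, one has
`|∇e(p)| ≤ C (t² + (R−1)²)^{−1/2}`. -/
theorem stmt16 (n : ℕ) (hn : 3 ≤ n) :
    DifferentiableOn ℝ (ePot n) (sphS n)ᶜ ∧
    ∃ C : ℝ, 0 < C ∧
      (∀ p : EucProd n, p ∉ sphS n →
        ‖fderiv ℝ (ePot n) p‖ ≤ C / Metric.infDist p (sphS n)) ∧
      (∀ p : EucProd n, p ∉ sphS n →
        ‖fderiv ℝ (ePot n) p‖ ≤
          C * ((fst' n p ^ 2 + (‖snd' n p‖ - 1) ^ 2) ^ (-(1 : ℝ) / 2))) := by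
  obtain ⟨C, hC, hmain⟩ := main_aux n hn
  have hclosed : IsClosed (sphS n) :=
    ((isCompact_sphere _ _).image (emb_cont n)).isClosed
  have hne : (sphS n).Nonempty := by
    have : Nonempty (Fin (n - 1)) := ⟨⟨0, by omega⟩⟩
    exact (NormedSpace.sphere_nonempty.2 zero_le_one).image _
  have hpos : ∀ p ∉ sphS n, 0 < Metric.infDist p (sphS n) := fun p hp =>
    (hclosed.notMem_iff_infDist_pos hne).1 hp
  have hle : ∀ p : EucProd n, ∀ y ∈ Metric.sphere (0 : EuclideanSpace ℝ (Fin (n - 1))) 1,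
      Metric.infDist p (sphS n) ≤ ‖p - emb n y‖ := by
    intro p y hy
    rw [← dist_eq_norm]
    exact Metric.infDist_le_dist_of_mem (Set.mem_image_of_mem _ hy)
  refine ⟨fun p hp => (hmain p _ (hpos p hp) (hle p)).1.differentiableWithinAt, C, hC,
    fun p hp => (hmain p _ (hpos p hp) (hle p)).2, fun p hp => ?_⟩
  set b := fst' n p ^ 2 + (‖snd' n p‖ - 1) ^ 2 with hb
  have hb0 : 0 ≤ b := by positivity
  have hbpos : 0 < b := by
    rcases hb0.lt_or_eq with h | h
    · exact h
    · exfalso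
      have h1 : fst' n p = 0 := by nlinarith [sq_nonneg (fst' n p), sq_nonneg (‖snd' n p‖ - 1)]
      have h2 : ‖snd' n p‖ - 1 = 0 := by
        nlinarith [sq_nonneg (fst' n p), sq_nonneg (‖snd' n p‖ - 1)]
      apply hp
      refine ⟨snd' n p, by simpa using sub_eq_zero.1 h2, ?_⟩
      have h3 := fst_snd_norm n p (snd' n p)
      rw [h1] at h3
      simp only [sub_self, norm_zero] at h3
      have : p - emb n (snd' n p) = 0 := by
        rw [← norm_eq_zero]; nlinarith [norm_nonneg (p - emb n (snd' n p))]
      exact (sub_eq_zero.1 this).symm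
  have key := (hmain p (√b) (Real.sqrt_pos.2 hbpos) (by
    intro y hy
    refine Real.sqrt_le_iff.2 ⟨norm_nonneg _, ?_⟩
    rw [fst_snd_norm, hb]
    have hy1 : ‖y‖ = 1 := by simpa using hy
    have := abs_norm_sub_norm_le (snd' n p) y
    rw [hy1] at this
    have := sq_le_sq' (by linarith [abs_nonneg (‖snd' n p‖ - 1), norm_nonneg (snd' n p - y)]) this
    rw [sq_abs] at this
    linarith)).2
  rw [neg_div, Real.rpow_neg hb0, ← Real.sqrt_eq_rpow, ← div_eq_mul_inv]
  exact key

end
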